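/- arXiv:2209.08872 — 8 statements merged into one kernel-verified Lean document; each statement's English description precedes it below -/
import Mathlib

section
/- Let 0 < α ≤ 1, b > 1 with α b > 1, and γ = 1 − 1/(α b − 1) (so γ < 1). Let g : [0,∞) → ℝ be continuous and bounded, and define u(t) = 1 − α + α (1−γ) b^{γ−1} ∫_0^b g(t x / b) x^{−γ} dx for t ≥ 0. Then u is differentiable on (0,∞) and satisfies t u'(t) = (1−γ) ( α g(t) − u(t) + 1 − α ) for all t > 0. In particular, if φ : [0,1] → ℝ is any function and g(t) = φ(u(t)) for all t ≥ 0 (with u taking values in [0,1]), then (α b − 1) u'(t) = (1/t) ( α φ(u(t)) − u(t) + 1 − α ) for all t > 0. -/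
open MeasureTheory Set

noncomputable section

/-- Rescaling the variable in an integral against a power weight. -/
lemma integral_comp_mul_div_mul_rpow (g : ℝ → ℝ) (r : ℝ) {b t : ℝ} (hb : 0 < b) (ht : 0 < t) :
    ∫ x in (0 : ℝ)..b, g (t * x / b) * x ^ (-r)
      = (t / b) ^ (r - 1) * ∫ y in (0 : ℝ)..t, g y * y ^ (-r) := by
  have hc : 0 < t / b := div_pos ht hb
  have key : ∫ x in (0 : ℝ)..b, g (t * x / b) * x ^ (-r)
      = ∫ x in (0 : ℝ)..b, (t / b) ^ r * (fun y => g y * y ^ (-r)) (t / b * x) := by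
    refine intervalIntegral.integral_congr fun x hx => ?_
    rw [uIcc_of_le hb.le] at hx
    have h1 : t * x / b = t / b * x := by ring
    have h2 : (t / b) ^ r * (t / b) ^ (-r) = 1 := by
      rw [← Real.rpow_add hc, add_neg_cancel, Real.rpow_zero]
    simp only [h1, Real.mul_rpow hc.le hx.1]
    linear_combination (-(g (t / b * x) * x ^ (-r))) * h2
  rw [key, intervalIntegral.integral_const_mul,
    intervalIntegral.integral_comp_mul_left (fun y => g y * y ^ (-r)) hc.ne',
    mul_zero, div_mul_cancel₀ t hb.ne', smul_eq_mul, ← mul_assoc, Real.rpow_sub_one hc.ne',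
    div_eq_mul_inv ((t / b) ^ r)]

/-- The fundamental theorem of calculus for a continuous function against an integrable
power weight. -/
lemma hasDerivAt_integral_mul_rpow {g : ℝ → ℝ} (hg : ContinuousOn g (Ici 0)) {r t : ℝ}
    (hr : r < 1) (ht : 0 < t) :
    HasDerivAt (fun s => ∫ y in (0 : ℝ)..s, g y * y ^ (-r)) (g t * t ^ (-r)) t := by
  have hcont : ContinuousOn (fun y => g y * y ^ (-r)) (Ioi 0) :=
    (hg.mono Ioi_subset_Ici_self).mul fun y hy =>
      (Real.continuousAt_rpow_const y (-r) (Or.inl (ne_of_gt hy))).continuousWithinAt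
  refine intervalIntegral.integral_hasDerivAt_right ?_
    (hcont.stronglyMeasurableAtFilter isOpen_Ioi t ht) (hcont.continuousAt (Ioi_mem_nhds ht))
  refine (intervalIntegral.intervalIntegrable_rpow' (by linarith)).continuousOn_mul
    (hg.mono ?_)
  rw [uIcc_of_le ht.le]
  exact Icc_subset_Ici_self

/-- The averaged function
`u(t) = 1 - α + α(1-γ) b^{γ-1} ∫_0^b g(tx/b) x^{-γ} dx` is differentiable on `(0,∞)`
and satisfies `t u'(t) = (1-γ)(α g(t) - u(t) + 1 - α)`; in particular if `g = φ ∘ u`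
then `(αb - 1) u'(t) = (1/t)(α φ(u(t)) - u(t) + 1 - α)`. -/
theorem deriv_of_averaged_laplace
    (α b γ : ℝ) (hα0 : 0 < α) (hα1 : α ≤ 1) (hb : 1 < b) (hαb : 1 < α * b)
    (hγ : γ = 1 - 1 / (α * b - 1))
    (g : ℝ → ℝ) (hgcont : ContinuousOn g (Ici 0)) (hgbdd : ∃ C, ∀ t ≥ (0 : ℝ), |g t| ≤ C)
    (u : ℝ → ℝ)
    (hu : ∀ t ≥ (0 : ℝ),
      u t = 1 - α + α * (1 - γ) * b ^ (γ - 1) * ∫ x in (0 : ℝ)..b, g (t * x / b) * x ^ (-γ)) :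
    (∀ t > (0 : ℝ), HasDerivAt u ((1 - γ) * (α * g t - u t + 1 - α) / t) t)
    ∧ (∀ φ : ℝ → ℝ, (∀ t ≥ (0 : ℝ), u t ∈ Icc (0 : ℝ) 1) → (∀ t ≥ (0 : ℝ), g t = φ (u t)) →
        ∀ t > (0 : ℝ),
          (α * b - 1) * deriv u t = (1 / t) * (α * φ (u t) - u t + 1 - α)) := by
  have hb0 : 0 < b := by linarith
  have hk : 0 < α * b - 1 := by linarith
  have hγ' : 1 - γ = 1 / (α * b - 1) := by rw [hγ]; ring
  have hγ1 : γ < 1 := by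
    have : 0 < 1 / (α * b - 1) := by positivity
    linarith
  have hu' : ∀ t > (0 : ℝ), u t = 1 - α + α * (1 - γ) *
      (t ^ (γ - 1) * ∫ y in (0 : ℝ)..t, g y * y ^ (-γ)) := by
    intro t ht
    rw [hu t ht.le, integral_comp_mul_div_mul_rpow g γ hb0 ht, Real.div_rpow ht.le hb0.le]
    have := (Real.rpow_pos_of_pos hb0 (γ - 1)).ne'
    field_simp
  have main : ∀ t > (0 : ℝ), HasDerivAt u ((1 - γ) * (α * g t - u t + 1 - α) / t) t := by
    intro t ht
    have hd := (((Real.hasDerivAt_rpow_const (p := γ - 1) (Or.inl ht.ne')).mul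
      (hasDerivAt_integral_mul_rpow hgcont hγ1 ht)).const_mul (α * (1 - γ))).const_add (1 - α)
    refine (hd.congr_of_eventuallyEq ?_).congr_deriv ?_
    · filter_upwards [Ioi_mem_nhds ht] with s hs using hu' s hs
    · have h1 : t ^ (γ - 1) * t ^ (-γ) = t⁻¹ := by
        rw [← Real.rpow_add ht, show γ - 1 + -γ = -1 by ring, Real.rpow_neg_one]
      rw [hu' t ht, Real.rpow_sub_one ht.ne' (γ - 1)]
      linear_combination α * (1 - γ) * g t * h1
  refine ⟨main, fun φ _ hφ t ht => ?_⟩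
  rw [(main t ht).deriv, hγ', hφ t ht.le]
  field_simp

end
end

section
/- Let N be a nonnegative integer-valued random variable with E[N²] < ∞, let φ(x) = E[x^N] be its probability generating function, b = φ'(1) = E[N], and let 0 < α ≤ 1 with α b > 1. Then the function ω(x) = (α b − 1)/( α φ(x) − x + 1 − α ) + 1/(1 − x), defined for x < 1 near 1, extends continuously to x = 1 with limit ω(1) = − α E[N(N−1)] / ( 2 (α b − 1) ); in particular ω is bounded in a neighborhood of 1. -/
open MeasureTheory ProbabilityTheory Filter Set

noncomputable section

/-- The second-order divided difference `(x ^ n - 1 - n (x - 1)) / (x - 1) ^ 2` of `x ^ n` at `1`,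
as a polynomial in `x`. -/
def powRemainder (n : ℕ) (x : ℝ) : ℝ :=
  ∑ i ∈ Finset.range n, ∑ j ∈ Finset.range i, x ^ j

lemma pow_eq_add_powRemainder (n : ℕ) (x : ℝ) :
    x ^ n = 1 - n * (1 - x) + (1 - x) ^ 2 * powRemainder n x := by
  induction n with
  | zero => simp [powRemainder]
  | succ k ih =>
    have hg := geom_sum_mul x k
    have hs : powRemainder (k + 1) x = powRemainder k x + ∑ j ∈ Finset.range k, x ^ j := by
      simp [powRemainder, Finset.sum_range_succ]
    rw [hs]
    push_cast
    linear_combination ih + (1 - x) * hg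

lemma abs_powRemainder_le (n : ℕ) {x : ℝ} (hx : |x| ≤ 1) :
    |powRemainder n x| ≤ (n : ℝ) ^ 2 := by
  have inner_le (i : ℕ) (hi : i ∈ Finset.range n) : |∑ j ∈ Finset.range i, x ^ j| ≤ n := by
    calc |∑ j ∈ Finset.range i, x ^ j| ≤ ∑ j ∈ Finset.range i, |x ^ j| :=
          Finset.abs_sum_le_sum_abs _ _
      _ ≤ ∑ _j ∈ Finset.range i, (1 : ℝ) := Finset.sum_le_sum fun j _ => by
          rw [abs_pow]; exact pow_le_one₀ (abs_nonneg x) hx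
      _ = i := by simp
      _ ≤ n := by exact_mod_cast (Finset.mem_range.1 hi).le
  calc |powRemainder n x| ≤ ∑ i ∈ Finset.range n, |∑ j ∈ Finset.range i, x ^ j| :=
        Finset.abs_sum_le_sum_abs _ _
    _ ≤ ∑ _i ∈ Finset.range n, (n : ℝ) := Finset.sum_le_sum inner_le
    _ = (n : ℝ) ^ 2 := by simp [sq]

lemma powRemainder_one (n : ℕ) : powRemainder n 1 = (n : ℝ) * ((n : ℝ) - 1) / 2 := by
  induction n with
  | zero => simp [powRemainder]
  | succ k ih =>
    simp only [powRemainder, one_pow, Finset.sum_const, Finset.card_range, nsmul_eq_mul, mul_one,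
      Finset.sum_range_succ] at ih ⊢
    rw [ih]
    push_cast
    ring

lemma continuous_powRemainder (n : ℕ) : Continuous (powRemainder n) := by
  unfold powRemainder
  fun_prop

section Moments

variable {Ω : Type*} [MeasurableSpace Ω] {μ : Measure Ω} {N : Ω → ℕ}

lemma aestronglyMeasurable_powRemainder (hN : Measurable N) (x : ℝ) :
    AEStronglyMeasurable (fun ω => powRemainder (N ω) x) μ :=
  ((Measurable.of_discrete (f := fun n : ℕ => powRemainder n x)).comp hN).aestronglyMeasurable

lemma integrable_powRemainder (hN : Measurable N) (hN2 : Integrable (fun ω => (N ω : ℝ) ^ 2) μ)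
    {x : ℝ} (hx : |x| ≤ 1) : Integrable (fun ω => powRemainder (N ω) x) μ :=
  hN2.mono' (aestronglyMeasurable_powRemainder hN x)
    (ae_of_all _ fun ω => abs_powRemainder_le (N ω) hx)

lemma integrable_natCast_of_sq (hN : Measurable N)
    (hN2 : Integrable (fun ω => (N ω : ℝ) ^ 2) μ) : Integrable (fun ω => (N ω : ℝ)) μ := by
  refine hN2.mono' (measurable_from_top.comp hN).aestronglyMeasurable (ae_of_all _ fun ω => ?_)
  rw [Real.norm_natCast]
  exact_mod_cast Nat.le_self_pow two_ne_zero (N ω)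

lemma integral_pow_eq_add_powRemainder [IsProbabilityMeasure μ] (hN : Measurable N)
    (hN2 : Integrable (fun ω => (N ω : ℝ) ^ 2) μ) {x : ℝ} (hx : |x| ≤ 1) :
    ∫ ω, x ^ N ω ∂μ = 1 - (∫ ω, (N ω : ℝ) ∂μ) * (1 - x)
      + (1 - x) ^ 2 * ∫ ω, powRemainder (N ω) x ∂μ := by
  have h1 : Integrable (fun ω => (N ω : ℝ) * (1 - x)) μ :=
    (integrable_natCast_of_sq hN hN2).mul_const _
  have h2 : Integrable (fun ω => (1 - x) ^ 2 * powRemainder (N ω) x) μ :=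
    (integrable_powRemainder hN hN2 hx).const_mul _
  have h3 : Integrable (fun ω => 1 - (N ω : ℝ) * (1 - x)) μ := (integrable_const 1).sub h1
  simp_rw [fun ω => pow_eq_add_powRemainder (N ω) x]
  rw [integral_add h3 h2, integral_sub (integrable_const 1) h1, integral_mul_const,
    integral_const_mul]
  simp

lemma eventually_abs_le_one_nhdsLT_one : ∀ᶠ x : ℝ in nhdsWithin 1 (Iio 1), |x| ≤ 1 := by
  filter_upwards [self_mem_nhdsWithin,
    mem_nhdsWithin_of_mem_nhds (Ioi_mem_nhds (zero_lt_one' ℝ))] with x hx1 hx0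
  exact abs_le.2 ⟨by linarith [mem_Ioi.1 hx0], (mem_Iio.1 hx1).le⟩

lemma tendsto_integral_powRemainder (hN : Measurable N)
    (hN2 : Integrable (fun ω => (N ω : ℝ) ^ 2) μ) :
    Tendsto (fun x => ∫ ω, powRemainder (N ω) x ∂μ) (nhdsWithin 1 (Iio 1))
      (nhds ((∫ ω, (N ω : ℝ) * ((N ω : ℝ) - 1) ∂μ) / 2)) := by
  rw [← integral_div]
  simp_rw [← powRemainder_one]
  refine tendsto_integral_filter_of_dominated_convergence (fun ω => (N ω : ℝ) ^ 2)
    (Eventually.of_forall fun x => aestronglyMeasurable_powRemainder hN x) ?_ hN2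
    (ae_of_all _ fun ω => (continuous_powRemainder (N ω)).continuousWithinAt)
  filter_upwards [eventually_abs_le_one_nhdsLT_one] with x hx
  exact ae_of_all _ fun ω => abs_powRemainder_le (N ω) hx

end Moments

/-- The function
`ω(x) = (αb - 1)/(α φ(x) - x + 1 - α) + 1/(1 - x)` extends continuously to `x = 1`
with limit `-α E[N(N-1)] / (2 (αb - 1))`; in particular it is bounded near `1`. -/
theorem omega_tendsto_at_one
    {Ω : Type*} [MeasureSpace Ω] [IsProbabilityMeasure (ℙ : Measure Ω)]
    (N : Ω → ℕ) (hNmeas : Measurable N)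
    (hN2 : Integrable (fun ω => (N ω : ℝ) ^ 2))
    (φ : ℝ → ℝ) (hφ : ∀ x, φ x = ∫ ω, x ^ (N ω))
    (b : ℝ) (hb : b = ∫ ω, (N ω : ℝ))
    (α : ℝ) (hα0 : 0 < α) (hα1 : α ≤ 1) (hαb : 1 < α * b) :
    Tendsto (fun x => (α * b - 1) / (α * φ x - x + 1 - α) + 1 / (1 - x))
        (nhdsWithin 1 (Iio 1))
        (nhds (-(α * ∫ ω, (N ω : ℝ) * ((N ω : ℝ) - 1)) / (2 * (α * b - 1))))
    ∧ ∃ C, ∀ᶠ x in nhdsWithin 1 (Iio 1),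
        |(α * b - 1) / (α * φ x - x + 1 - α) + 1 / (1 - x)| ≤ C := by
  suffices h : Tendsto (fun x => (α * b - 1) / (α * φ x - x + 1 - α) + 1 / (1 - x))
      (nhdsWithin 1 (Iio 1))
      (nhds (-(α * ∫ ω, (N ω : ℝ) * ((N ω : ℝ) - 1)) / (2 * (α * b - 1)))) from
    ⟨h, h.abs.isBoundedUnder_le⟩
  have hm : 0 < α * b - 1 := by linarith
  set Q : ℝ → ℝ := fun x => ∫ ω, powRemainder (N ω) x with hQ
  set c : ℝ := ∫ ω, (N ω : ℝ) * ((N ω : ℝ) - 1) with hc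
  have hQlim : Tendsto Q (nhdsWithin 1 (Iio 1)) (nhds (c / 2)) :=
    tendsto_integral_powRemainder hNmeas hN2
  have hsub : Tendsto (fun x : ℝ => 1 - x) (nhdsWithin 1 (Iio 1)) (nhds 0) := by
    have : Tendsto (fun x : ℝ => 1 - x) (nhds 1) (nhds (1 - 1)) :=
      (continuous_const.sub continuous_id).tendsto 1
    rw [sub_self] at this
    exact this.mono_left nhdsWithin_le_nhds
  have hden : Tendsto (fun x => α * (1 - x) * Q x - (α * b - 1)) (nhdsWithin 1 (Iio 1))
      (nhds (-(α * b - 1))) := by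
    simpa using ((hsub.const_mul α).mul hQlim).sub_const (α * b - 1)
  have hlim : Tendsto (fun x => α * Q x / (α * (1 - x) * Q x - (α * b - 1)))
      (nhdsWithin 1 (Iio 1)) (nhds (α * (c / 2) / (-(α * b - 1)))) :=
    (hQlim.const_mul α).div hden (neg_ne_zero.2 hm.ne')
  have hval : -(α * c) / (2 * (α * b - 1)) = α * (c / 2) / (-(α * b - 1)) := by
    rw [div_neg, neg_div]
    field_simp
  rw [hval]
  refine hlim.congr' ?_
  filter_upwards [self_mem_nhdsWithin, eventually_abs_le_one_nhdsLT_one,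
    hden.eventually_ne (neg_ne_zero.2 hm.ne')] with x hx1 hx hne
  have hx' : 1 - x ≠ 0 := (sub_pos.2 (mem_Iio.1 hx1)).ne'
  have hφx : α * φ x - x + 1 - α = (1 - x) * (α * (1 - x) * Q x - (α * b - 1)) := by
    rw [hφ, integral_pow_eq_add_powRemainder hNmeas hN2 hx, hb]
    ring
  rw [hφx]
  generalize hd : α * (1 - x) * Q x - (α * b - 1) = d at hne ⊢
  field_simp
  linear_combination hd

end
end

section
/- Let N be a nonnegative integer-valued random variable with P(N ≥ 2) > 0 and E[N²] < ∞, let φ(x) = E[x^N], b = E[N], and let 0 < α ≤ 1 with α b > 1. Let β ∈ [0,1) satisfy β = φ(αβ + 1 − α) and set x_0 = αβ + 1 − α. Define ω(x) = (α b − 1)/( α φ(x) − x + 1 − α ) + 1/(1 − x) for x ∈ (x_0, 1), extended continuously at x = 1, and Ω(x) = exp( ∫_1^x ω(τ) dτ ). Then the function x ↦ (1 − x) Ω(x) is strictly decreasing on (x_0, 1], with value 0 at x = 1. -/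
open MeasureTheory ProbabilityTheory Set

noncomputable section

/-- On `[0, 1]` the powers `x ^ N` of a natural-valued random variable are integrable. -/
lemma integrable_pow_of_mem_Icc {Ω : Type*} [MeasurableSpace Ω] {μ : Measure Ω}
    [IsFiniteMeasure μ] {N : Ω → ℕ} (hN : Measurable N) {x : ℝ} (hx : x ∈ Icc (0 : ℝ) 1) :
    Integrable (fun ω => x ^ N ω) μ := by
  refine Integrable.of_bound (C := 1) ?_ (.of_forall fun ω => ?_)
  · exact ((measurable_from_top (f := fun n : ℕ => x ^ n)).comp hN).aestronglyMeasurable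
  · rw [Real.norm_of_nonneg (pow_nonneg hx.1 _)]
    exact pow_le_one₀ hx.1 hx.2

/-- The generating function of a natural-valued random variable that is at least `2` with positive
probability is strictly convex on `[0, 1]`. -/
lemma strictConvexOn_integral_pow {Ω : Type*} [MeasurableSpace Ω] {μ : Measure Ω}
    [IsFiniteMeasure μ] {N : Ω → ℕ} (hN : Measurable N) (hpos : 0 < μ {ω | 2 ≤ N ω}) :
    StrictConvexOn ℝ (Icc (0 : ℝ) 1) (fun x => ∫ ω, x ^ N ω ∂μ) := by
  refine ⟨convex_Icc 0 1, fun x hx y hy hxy a c ha hc hac => ?_⟩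
  have hz : a • x + c • y ∈ Icc (0 : ℝ) 1 := convex_Icc 0 1 hx hy ha.le hc.le hac
  have hix := (integrable_pow_of_mem_Icc (μ := μ) hN hx).const_mul a
  have hiy := (integrable_pow_of_mem_Icc (μ := μ) hN hy).const_mul c
  have hiz := integrable_pow_of_mem_Icc (μ := μ) hN hz
  have hgap : 0 < ∫ ω, (a * x ^ N ω + c * y ^ N ω - (a • x + c • y) ^ N ω) ∂μ := by
    rw [integral_pos_iff_support_of_nonneg]
    · refine hpos.trans_le (measure_mono fun ω hω => ?_)
      exact (sub_pos.2 ((strictConvexOn_pow hω).2 hx.1 hy.1 hxy ha hc hac)).ne'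
    · exact fun ω => sub_nonneg.2 ((convexOn_pow (N ω)).2 hx.1 hy.1 ha.le hc.le hac)
    · exact (hix.add hiy).sub hiz
  rw [integral_sub (hix.fun_add hiy) hiz, integral_add hix hiy, integral_const_mul,
    integral_const_mul] at hgap
  simpa only [smul_eq_mul, sub_pos] using hgap

/-- With `Ω(x) = exp ∫_1^x ω(τ) dτ`, where `ω` is the function
`ω(x) = (αb-1)/(αφ(x) - x + 1 - α) + 1/(1-x)` extended continuously at `1`,
the function `x ↦ (1 - x) Ω(x)` is strictly decreasing on `(x₀, 1]` and vanishes
at `x = 1`. -/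
theorem one_sub_mul_Omega_strictAnti
    {Ω : Type*} [MeasureSpace Ω] [IsProbabilityMeasure (ℙ : Measure Ω)]
    (N : Ω → ℕ) (hNmeas : Measurable N)
    (hN2pos : 0 < ℙ {ω | 2 ≤ N ω})
    (hN2 : Integrable (fun ω => (N ω : ℝ) ^ 2))
    (φ : ℝ → ℝ) (hφ : ∀ x, φ x = ∫ ω, x ^ (N ω))
    (b : ℝ) (hb : b = ∫ ω, (N ω : ℝ))
    (α : ℝ) (hα0 : 0 < α) (hα1 : α ≤ 1) (hαb : 1 < α * b)
    (β : ℝ) (hβ : β ∈ Ico (0 : ℝ) 1) (hβfix : β = φ (α * β + 1 - α))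
    (x₀ : ℝ) (hx₀ : x₀ = α * β + 1 - α)
    (ω' : ℝ → ℝ)
    (hω' : ∀ x ∈ Ioo x₀ 1, ω' x = (α * b - 1) / (α * φ x - x + 1 - α) + 1 / (1 - x))
    (hω'cont : ContinuousWithinAt ω' (Iio 1) 1)
    (Ω' : ℝ → ℝ) (hΩ' : ∀ x, Ω' x = Real.exp (∫ τ in (1 : ℝ)..x, ω' τ)) :
    StrictAntiOn (fun x => (1 - x) * Ω' x) (Ioc x₀ 1)
    ∧ (1 - 1) * Ω' 1 = 0 := by
  refine ⟨?_, by simp⟩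
  have hβ0 := hβ.1
  have hβ1 := hβ.2
  have hx₀nonneg : 0 ≤ x₀ := by rw [hx₀]; nlinarith
  have hφconv : StrictConvexOn ℝ (Icc (0 : ℝ) 1) φ := by
    rw [funext hφ]
    exact strictConvexOn_integral_pow hNmeas hN2pos
  have hφcont : ContinuousOn φ (Ioo 0 1) := by
    simpa only [interior_Icc] using hφconv.convexOn.continuousOn_interior
  have hφ1 : φ 1 = 1 := by simp [hφ]
  have hφx₀ : φ x₀ = β := by rw [hx₀, ← hβfix]
  have hDneg : ∀ x ∈ Ioo x₀ 1, α * φ x - x + 1 - α < 0 := by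
    intro x hx
    have hx₀1 : x₀ < 1 := hx.1.trans hx.2
    obtain ⟨a, c, ha, hc, hac, rfl⟩ : x ∈ openSegment ℝ x₀ 1 := by
      rwa [openSegment_eq_Ioo hx₀1]
    have h := hφconv.2 ⟨hx₀nonneg, hx₀1.le⟩ ⟨zero_le_one, le_rfl⟩ hx₀1.ne ha hc hac
    rw [hφ1, hφx₀] at h
    simp only [smul_eq_mul] at h ⊢
    obtain rfl : c = 1 - a := by linarith
    have h' := mul_lt_mul_of_pos_left h hα0
    rw [hx₀] at h' ⊢
    linarith
  have hωcont : ContinuousOn ω' (Ioo x₀ 1) := by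
    have hφ' : ContinuousOn φ (Ioo x₀ 1) := hφcont.mono (Ioo_subset_Ioo_left hx₀nonneg)
    refine ContinuousOn.congr (.add (.div (by fun_prop) (by fun_prop) fun x hx => (hDneg x hx).ne)
      (.div (by fun_prop) (by fun_prop) fun x hx => (sub_pos.2 hx.2).ne')) hω'
  have hωint : ∀ x ∈ Ioo x₀ 1, IntervalIntegrable ω' volume 1 x := by
    intro x hx
    refine ContinuousOn.intervalIntegrable fun y hy => ?_
    rw [uIcc_of_ge hx.2.le] at hy
    obtain rfl | hy1 := hy.2.eq_or_lt
    · refine (continuousWithinAt_insert_self.2 hω'cont).mono fun z hz => ?_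
      rw [uIcc_of_ge hx.2.le] at hz
      exact hz.2.eq_or_lt
    · exact (hωcont.continuousAt (isOpen_Ioo.mem_nhds ⟨hx.1.trans_le hy.1, hy1⟩)).continuousWithinAt
  have hderiv : ∀ x ∈ Ioo x₀ 1, HasDerivAt (fun x => (1 - x) * Ω' x)
      (Ω' x * (1 - x) * (α * b - 1) / (α * φ x - x + 1 - α)) x := by
    intro x hx
    have hnhds := isOpen_Ioo.mem_nhds hx
    have hprim := intervalIntegral.integral_hasDerivAt_right (hωint x hx)
      (hωcont.stronglyMeasurableAtFilter isOpen_Ioo x hx) (hωcont.continuousAt hnhds)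
    have hΩ := hprim.exp
    simp only [← hΩ'] at hΩ
    refine (((hasDerivAt_id x).const_sub 1).mul hΩ).congr_deriv ?_
    have h1 : 1 - x ≠ 0 := (sub_pos.2 hx.2).ne'
    have hD := (hDneg x hx).ne
    rw [hω' x hx]
    simp only [id]
    field_simp
    ring
  have hΩpos : ∀ x, 0 < Ω' x := fun x => by rw [hΩ']; exact Real.exp_pos _
  have hanti : StrictAntiOn (fun x => (1 - x) * Ω' x) (Ioo x₀ 1) := by
    refine strictAntiOn_of_deriv_neg (convex_Ioo x₀ 1)
      (fun x hx => (hderiv x hx).continuousAt.continuousWithinAt) fun x hx => ?_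
    rw [interior_Ioo] at hx
    rw [(hderiv x hx).deriv]
    exact div_neg_of_pos_of_neg
      (mul_pos (mul_pos (hΩpos x) (sub_pos.2 hx.2)) (sub_pos.2 hαb)) (hDneg x hx)
  intro x hx y hy hxy
  obtain rfl | hy1 := hy.2.eq_or_lt
  · simpa using mul_pos (sub_pos.2 hxy) (hΩpos x)
  · exact hanti ⟨hx.1, hxy.trans hy1⟩ ⟨hy.1, hy1⟩ hxy

end
end

section
/- Let n ≥ 1 be an integer, b = n + 1, γ = 1 − 1/n, and g(t) = (1 + n t/(n+1))^{−(n+1)/n} for t ≥ 0. Then for every t ≥ 0, (1−γ) b^{γ−1} ∫_0^b g(t x / b) x^{−γ} dx = (1 + n t/(n+1))^{−1/n}. Consequently g(t) = ( (1−γ) b^{γ−1} ∫_0^b g(t x / b) x^{−γ} dx )^{n+1}, i.e., g satisfies the Laplace-transform fixed-point equation g(t) = φ( ∫ g(t x / b) μ(dx) ) with φ(x) = x^{n+1} and μ(dx) = (1−γ) b^{γ−1} x^{−γ} 1_{(0,b)}(x) dx. -/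
open MeasureTheory Set

noncomputable section

theorem integral_one_add_mul_rpow_mul_rpow {p c b : ℝ} (hp : 0 < p) (hc : 0 ≤ c) (hb : 0 ≤ b) :
    ∫ x in (0 : ℝ)..b, (1 + c * x) ^ (-(1 + p)) * x ^ (p - 1) =
      p⁻¹ * (b ^ p * (1 + c * b) ^ (-p)) := by
  have hpos : ∀ x : ℝ, 0 ≤ x → 0 < 1 + c * x := fun x hx => by positivity
  have hcont : ∀ q : ℝ, ContinuousOn (fun x : ℝ => (1 + c * x) ^ q) (Icc 0 b) := fun q =>
    ContinuousOn.rpow_const (by fun_prop) fun x hx => Or.inl (hpos x hx.1).ne'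
  have hderiv : ∀ x ∈ Ioo 0 b, HasDerivAt (fun x : ℝ => p⁻¹ * (x ^ p * (1 + c * x) ^ (-p)))
      ((1 + c * x) ^ (-(1 + p)) * x ^ (p - 1)) x := by
    intro x hx
    have h1 := hpos x hx.1.le
    have hlin : HasDerivAt (fun x : ℝ => 1 + c * x) c x := by
      simpa using ((hasDerivAt_id x).const_mul c).const_add 1
    have h := ((Real.hasDerivAt_rpow_const (p := p) (Or.inl hx.1.ne')).mul
      (hlin.rpow_const (p := -p) (Or.inl h1.ne'))).const_mul p⁻¹
    refine h.congr_deriv ?_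
    have e1 : x ^ p = x ^ (p - 1) * x := by
      rw [← Real.rpow_add_one hx.1.ne', sub_add_cancel]
    have e2 : (1 + c * x) ^ (-p) = (1 + c * x) ^ (-(1 + p)) * (1 + c * x) := by
      rw [← Real.rpow_add_one h1.ne']
      congr 1
      ring
    have e3 : -p - 1 = -(1 + p) := by ring
    rw [e1, e2, e3]
    field_simp
    ring
  have hint : IntervalIntegrable (fun x : ℝ => (1 + c * x) ^ (-(1 + p)) * x ^ (p - 1))
      volume 0 b :=
    (intervalIntegral.intervalIntegrable_rpow' (by linarith)).continuousOn_mul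
      (by rw [uIcc_of_le hb]; exact hcont _)
  rw [intervalIntegral.integral_eq_sub_of_hasDerivAt_of_le hb
    (continuousOn_const.mul ((Real.continuous_rpow_const hp.le).continuousOn.mul (hcont _)))
    hderiv hint]
  simp [Real.zero_rpow hp.ne']

theorem integral_withDensity_indicator_Ioo {b : ℝ} (hb : 0 ≤ b) {w : ℝ → ℝ} (hw : Measurable w)
    (hw0 : ∀ x ∈ Ioo 0 b, 0 ≤ w x) (f : ℝ → ℝ) :
    ∫ x, f x ∂(volume.withDensity fun x => ENNReal.ofReal ((Ioo 0 b).indicator w x)) =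
      ∫ x in (0 : ℝ)..b, w x * f x := by
  rw [integral_withDensity_eq_integral_toReal_smul
    (hw.indicator measurableSet_Ioo).ennreal_ofReal (by simp),
    intervalIntegral.integral_of_le hb, integral_Ioc_eq_integral_Ioo,
    ← integral_indicator measurableSet_Ioo]
  congr 1 with x
  rw [ENNReal.toReal_ofReal (indicator_nonneg hw0 x), smul_eq_mul]
  by_cases hx : x ∈ Ioo 0 b <;> simp [hx]

/-- Example 1 of the paper: with `b = n+1`, `γ = 1 - 1/n` and
`g(t) = (1 + nt/(n+1))^{-(n+1)/n}`, the function `g` satisfies the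
Laplace-transform fixed-point equation `g(t) = φ(∫ g(tx/b) μ(dx))` for
`φ(x) = x^{n+1}` and `μ(dx) = (1-γ) b^{γ-1} x^{-γ} 1_{(0,b)}(x) dx`. -/
theorem example1_gamma_fixed_point
    (n : ℕ) (hn : 1 ≤ n) (b γ : ℝ) (hb : b = (n : ℝ) + 1) (hγ : γ = 1 - 1 / (n : ℝ))
    (g : ℝ → ℝ)
    (hg : ∀ t, g t = (1 + (n : ℝ) * t / ((n : ℝ) + 1)) ^ (-(((n : ℝ) + 1) / (n : ℝ))))
    (μ : Measure ℝ)
    (hμ : μ = volume.withDensity (fun x =>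
      ENNReal.ofReal ((Ioo (0 : ℝ) b).indicator
        (fun x => (1 - γ) * b ^ (γ - 1) * x ^ (-γ)) x))) :
    ∀ t ≥ (0 : ℝ),
      (1 - γ) * b ^ (γ - 1) * (∫ x in (0 : ℝ)..b, g (t * x / b) * x ^ (-γ))
          = (1 + (n : ℝ) * t / ((n : ℝ) + 1)) ^ (-(1 / (n : ℝ)))
      ∧ g t = ((1 - γ) * b ^ (γ - 1) * ∫ x in (0 : ℝ)..b, g (t * x / b) * x ^ (-γ)) ^ (n + 1)
      ∧ g t = (∫ x, g (t * x / b) ∂μ) ^ (n + 1) := by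
  intro t ht
  have hn0 : (0 : ℝ) < n := by exact_mod_cast hn
  have hb0 : 0 < b := by rw [hb]; positivity
  have hp : (0 : ℝ) < 1 / n := by positivity
  have hγ' : 1 - γ = 1 / n := by rw [hγ]; ring
  have hbase : 0 < 1 + (n : ℝ) * t / ((n : ℝ) + 1) := by positivity
  have hmain : (1 - γ) * b ^ (γ - 1) * (∫ x in (0 : ℝ)..b, g (t * x / b) * x ^ (-γ))
      = (1 + (n : ℝ) * t / ((n : ℝ) + 1)) ^ (-(1 / (n : ℝ))) := by
    have hfun : ∀ x : ℝ, g (t * x / b) * x ^ (-γ) =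
        (1 + n * t / (n + 1) / b * x) ^ (-(1 + 1 / (n : ℝ))) * x ^ (1 / (n : ℝ) - 1) := by
      intro x
      rw [hg]
      congr 2
      · ring
      · field_simp
      · rw [hγ]; ring
    simp_rw [hfun]
    rw [integral_one_add_mul_rpow_mul_rpow hp (by positivity) hb0.le, hγ',
      div_mul_cancel₀ _ hb0.ne', show γ - 1 = -(1 / (n : ℝ)) by rw [hγ]; ring,
      Real.rpow_neg hb0.le]
    have := Real.rpow_pos_of_pos hb0 (1 / (n : ℝ))
    field_simp
  have hpow : g t = ((1 - γ) * b ^ (γ - 1) *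
      ∫ x in (0 : ℝ)..b, g (t * x / b) * x ^ (-γ)) ^ (n + 1) := by
    rw [hmain, hg, ← Real.rpow_mul_natCast hbase.le]
    congr 1
    push_cast
    field_simp
  refine ⟨hmain, hpow, ?_⟩
  have hw0 : ∀ x ∈ Ioo 0 b, 0 ≤ (1 - γ) * b ^ (γ - 1) * x ^ (-γ) := by
    intro x hx
    have := hx.1
    rw [hγ']
    positivity
  rw [hpow, hμ, integral_withDensity_indicator_Ioo hb0.le (by fun_prop) hw0,
    ← intervalIntegral.integral_const_mul]
  congr 2 with x
  ring

end
end

section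
/- Let 0 < ρ ≤ 1 and 1/(2ρ) < α ≤ 1, and set b = 2ρ, γ = 1 − 1/(2αρ − 1). Define g(t) = (α²ρ − 2αρ + 1)/(α²ρ) + 4(1−αρ)(2αρ−1)²/( ρ α² (4αρ + αt − 2) ) + 4(2αρ−1)⁴/( ρ α² (4αρ + αt − 2)² ) and u(t) = (1−αρ)/(αρ) + 2(2αρ−1)²/( αρ (4αρ + αt − 2) ) for t ≥ 0. Then for every t ≥ 0: (i) u(t) = 1 − α + α(1−γ) b^{γ−1} ∫_0^b g(t x / b) x^{−γ} dx, and (ii) g(t) = 1 − ρ + ρ u(t)². Hence g satisfies the Laplace-transform fixed-point equation g(t) = φ( ∫ g(t x / b) μ(dx) ) with φ(x) = 1 − ρ + ρ x² and μ(dx) = (1−α) δ_0(dx) + α(1−γ) b^{γ−1} x^{−γ} 1_{(0,b)}(x) dx. -/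
open MeasureTheory Set

noncomputable section

/-- Example 2 of the paper: with `φ(x) = 1 - ρ + ρx²`,
`b = 2ρ`, `γ = 1 - 1/(2αρ - 1)`, the explicit functions `g` and `u` satisfy
`u(t) = 1 - α + α(1-γ) b^{γ-1} ∫_0^b g(tx/b) x^{-γ} dx` and `g(t) = 1 - ρ + ρ u(t)²`,
hence `g` satisfies the Laplace-transform fixed-point equation for `(φ, μ)`. -/
theorem example2_fixed_point
    (ρ α : ℝ) (hρ0 : 0 < ρ) (hρ1 : ρ ≤ 1) (hα : 1 / (2 * ρ) < α) (hα1 : α ≤ 1)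
    (b γ : ℝ) (hb : b = 2 * ρ) (hγ : γ = 1 - 1 / (2 * α * ρ - 1))
    (g u : ℝ → ℝ)
    (hg : ∀ t, g t = (α ^ 2 * ρ - 2 * α * ρ + 1) / (α ^ 2 * ρ)
      + 4 * (1 - α * ρ) * (2 * α * ρ - 1) ^ 2 / (ρ * α ^ 2 * (4 * α * ρ + α * t - 2))
      + 4 * (2 * α * ρ - 1) ^ 4 / (ρ * α ^ 2 * (4 * α * ρ + α * t - 2) ^ 2))
    (hu : ∀ t, u t = (1 - α * ρ) / (α * ρ)
      + 2 * (2 * α * ρ - 1) ^ 2 / (α * ρ * (4 * α * ρ + α * t - 2)))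
    (μ : Measure ℝ)
    (hμ : μ = (ENNReal.ofReal (1 - α)) • Measure.dirac (0 : ℝ)
      + volume.withDensity (fun x =>
          ENNReal.ofReal ((Ioo (0 : ℝ) b).indicator
            (fun x => α * (1 - γ) * b ^ (γ - 1) * x ^ (-γ)) x))) :
    ∀ t ≥ (0 : ℝ),
      u t = 1 - α + α * (1 - γ) * b ^ (γ - 1)
          * ∫ x in (0 : ℝ)..b, g (t * x / b) * x ^ (-γ)
      ∧ g t = 1 - ρ + ρ * (u t) ^ 2
      ∧ g t = 1 - ρ + ρ * (∫ x, g (t * x / b) ∂μ) ^ 2 := by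
  intro t ht
  have hp : 1 < 2 * α * ρ := by
    rw [div_lt_iff₀ (by positivity)] at hα
    linarith
  have hα0 : 0 < α := lt_trans (by positivity) hα
  have hαρ : α * ρ ≤ 1 := by nlinarith
  have hc0 : 0 < 2 * α * ρ - 1 := by linarith
  have hγ0 : γ ≤ 0 := by
    have : 1 ≤ 1 / (2 * α * ρ - 1) := by
      rw [le_div_iff₀ hc0]
      linarith
    linarith
  have hb0 : 0 < b := by linarith
  have hD : ∀ s, 0 ≤ s → 0 < 4 * α * ρ + α * s - 2 := fun s hs => by
    have := mul_nonneg hα0.le hs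
    linarith
  have hgu : ∀ s, 0 ≤ s → g s = 1 - ρ + ρ * (u s) ^ 2 := fun s hs => by
    have := (hD s hs).ne'
    rw [hg, hu]
    generalize 4 * α * ρ + α * s - 2 = D at *
    field_simp
    ring
  have harg : ∀ x ∈ Icc 0 b, 0 ≤ t * x / b := fun x hx =>
    div_nonneg (mul_nonneg ht hx.1) hb0.le
  have hu' : ∀ s, 0 ≤ s → HasDerivAt u
      (-(2 * (2 * α * ρ - 1) ^ 2 / (ρ * (4 * α * ρ + α * s - 2) ^ 2))) s := by
    intro s hs
    have hDs := (hD s hs).ne'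
    have h1 : HasDerivAt (fun s => α * ρ * (4 * α * ρ + α * s - 2)) (α * ρ * α) s := by
      simpa using ((((hasDerivAt_id s).const_mul α).const_add (4 * α * ρ)).sub_const 2).const_mul
        (α * ρ)
    rw [funext hu]
    refine (((hasDerivAt_const s (2 * (2 * α * ρ - 1) ^ 2)).div h1 (by positivity)).const_add
      ((1 - α * ρ) / (α * ρ))).congr_deriv ?_
    field_simp
    ring
  have hode : ∀ s, 0 ≤ s → (1 - γ) * (u s - 1 + α)
      - s * (2 * (2 * α * ρ - 1) ^ 2 / (ρ * (4 * α * ρ + α * s - 2) ^ 2))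
      = α * (1 - γ) * g s := by
    intro s hs
    have hDs := (hD s hs).ne'
    rw [hgu s hs, hu, hγ]
    generalize hDdef : 4 * α * ρ + α * s - 2 = D at hDs ⊢
    have hs' : s = (D - 2 * (2 * α * ρ - 1)) / α := by
      rw [eq_div_iff hα0.ne']
      linarith
    rw [hs']
    have := hc0.ne'
    field_simp
    ring
  have hderiv : ∀ x ∈ uIcc 0 b,
      HasDerivAt (fun x => b ^ (γ - 1) * (x ^ (1 - γ) * (u (t * x / b) - 1 + α)))
        (α * (1 - γ) * b ^ (γ - 1) * (g (t * x / b) * x ^ (-γ))) x := by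
    intro x hx
    rw [uIcc_of_le hb0.le] at hx
    have hlin : HasDerivAt (fun x => t * x / b) (t / b) x := by
      simpa using ((hasDerivAt_id x).const_mul t).div_const b
    have hrpow := Real.hasDerivAt_rpow_const (x := x) (p := 1 - γ) (Or.inr (by linarith))
    have hcomp := (((hu' _ (harg x hx)).comp x hlin).sub_const 1).add_const α
    refine ((hrpow.mul hcomp).const_mul (b ^ (γ - 1))).congr_deriv ?_
    have hx1 : x ^ (1 - γ) = x * x ^ (-γ) := by
      rw [sub_eq_add_neg, Real.rpow_add_of_nonneg hx.1 zero_le_one (by linarith), Real.rpow_one]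
    rw [hx1, show 1 - γ - 1 = -γ by ring, Function.comp_apply]
    linear_combination b ^ (γ - 1) * x ^ (-γ) * hode _ (harg x hx)
  have hcont : ContinuousOn (fun x => g (t * x / b) * x ^ (-γ)) (Icc 0 b) := by
    refine ContinuousOn.mul ?_ (Real.continuous_rpow_const (by linarith)).continuousOn
    simp only [hg]
    have h (x) (hx : x ∈ Icc 0 b) : 4 * α * ρ + α * (t * x / b) - 2 ≠ 0 := (hD _ (harg x hx)).ne'
    refine ContinuousOn.add (ContinuousOn.add continuousOn_const ?_) ?_ <;>
      refine ContinuousOn.div (by fun_prop) (by fun_prop) fun x hx => ?_ <;>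
      have := h x hx <;> positivity
  have hcont' := hcont.const_smul (α * (1 - γ) * b ^ (γ - 1))
  have hprimitive : ∫ x in (0 : ℝ)..b, α * (1 - γ) * b ^ (γ - 1) * (g (t * x / b) * x ^ (-γ))
      = u t - 1 + α := by
    rw [intervalIntegral.integral_eq_sub_of_hasDerivAt hderiv
      (hcont'.intervalIntegrable_of_Icc hb0.le), mul_div_cancel_right₀ _ hb0.ne',
      Real.zero_rpow (by linarith), ← mul_assoc, ← Real.rpow_add hb0]
    simp
  have hui : u t = 1 - α + α * (1 - γ) * b ^ (γ - 1)
      * ∫ x in (0 : ℝ)..b, g (t * x / b) * x ^ (-γ) := by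
    rw [← intervalIntegral.integral_const_mul, hprimitive]
    ring
  have hdens : ∀ x, (ENNReal.ofReal ((Ioo (0 : ℝ) b).indicator
      (fun x => α * (1 - γ) * b ^ (γ - 1) * x ^ (-γ)) x)).toReal • g (t * x / b)
      = (Ioo (0 : ℝ) b).indicator
        (fun x => α * (1 - γ) * b ^ (γ - 1) * (g (t * x / b) * x ^ (-γ))) x := by
    intro x
    by_cases hx : x ∈ Ioo 0 b
    · have h1 : 0 ≤ α * (1 - γ) * b ^ (γ - 1) * x ^ (-γ) := by
        have := Real.rpow_nonneg hx.1.le (-γ)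
        have : 0 ≤ 1 - γ := by linarith
        positivity
      rw [indicator_of_mem hx, indicator_of_mem hx, ENNReal.toReal_ofReal h1, smul_eq_mul]
      ring
    · simp [hx]
  have hmeas : Measurable (fun x => ENNReal.ofReal ((Ioo (0 : ℝ) b).indicator
      (fun x => α * (1 - γ) * b ^ (γ - 1) * x ^ (-γ)) x)) :=
    (Measurable.indicator (by fun_prop) measurableSet_Ioo).ennreal_ofReal
  have hfin : ∀ᵐ x, ENNReal.ofReal ((Ioo (0 : ℝ) b).indicator
      (fun x => α * (1 - γ) * b ^ (γ - 1) * x ^ (-γ)) x) < ⊤ :=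
    Filter.Eventually.of_forall fun _ => ENNReal.ofReal_lt_top
  have hg0 : g 0 = 1 := by
    have h0 := (hD 0 le_rfl).ne'
    rw [hg]
    simp only [mul_zero, add_zero] at h0 ⊢
    have : 4 * α * ρ - 2 = 2 * (2 * α * ρ - 1) := by ring
    rw [this]
    field_simp
    ring
  have hμint : ∫ x, g (t * x / b) ∂μ = u t := by
    rw [hμ, integral_add_measure, integral_smul_measure, integral_dirac,
      integral_withDensity_eq_integral_toReal_smul hmeas hfin]
    · simp only [hdens]
      rw [integral_indicator measurableSet_Ioo, ← integral_Ioc_eq_integral_Ioo,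
        ← intervalIntegral.integral_of_le hb0.le, hprimitive, mul_zero, zero_div, hg0,
        ENNReal.toReal_ofReal (by linarith), smul_eq_mul]
      ring
    · exact (integrable_dirac (by simp)).smul_measure ENNReal.ofReal_ne_top
    · rw [integrable_withDensity_iff_integrable_smul' hmeas hfin]
      simp only [hdens]
      rw [integrable_indicator_iff measurableSet_Ioo]
      exact (hcont'.integrableOn_compact isCompact_Icc).mono_set Ioo_subset_Icc_self
  exact ⟨hui, hgu t ht, by rw [hμint]; exact hgu t ht⟩

end
end

section
/- Let 0 < ρ ≤ 1 and let n ≥ 1 be an integer with ρ n > 1; set b = ρn + 1, γ = (ρn − 1)/(ρn), u(t) = (1 + n t/(ρn+1))^{−1/n}, and g(t) = (1−ρ) u(t) + ρ u(t)^{n+1} for t ≥ 0. Then for every t ≥ 0, (1−γ) b^{γ−1} ∫_0^b g(t x / b) x^{−γ} dx = u(t). Hence g satisfies the Laplace-transform fixed-point equation g(t) = φ( ∫ g(t x / b) μ(dx) ) with φ(x) = (1−ρ) x + ρ x^{n+1} and μ(dx) = (1−γ) b^{γ−1} x^{−γ} 1_{(0,b)}(x) dx. -/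
open MeasureTheory Set

noncomputable section

/-- For `v x = (1 + c x)^(-1/n)`, the function `x^(1/(ρn)) v x` is a primitive of
`x^(1/(ρn) - 1) ((1 - ρ) v x + ρ (v x)^(n+1)) / (ρn)` on the positive half-line. -/
lemma hasDerivAt_rpow_mul_rpow_affine {ρ c x : ℝ} {n : ℕ} (hρ : ρ ≠ 0) (hn : n ≠ 0)
    (hc : 0 ≤ c) (hx : 0 < x) :
    HasDerivAt (fun x : ℝ => x ^ (1 / (ρ * n)) * (1 + c * x) ^ (-(1 / (n : ℝ))))
      (1 / (ρ * n) * (((1 - ρ) * (1 + c * x) ^ (-(1 / (n : ℝ)))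
        + ρ * ((1 + c * x) ^ (-(1 / (n : ℝ)))) ^ (n + 1)) * x ^ (1 / (ρ * n) - 1))) x := by
  have hn' : (n : ℝ) ≠ 0 := Nat.cast_ne_zero.mpr hn
  have hpos : 0 < 1 + c * x := by positivity
  have hlin : HasDerivAt (fun x : ℝ => 1 + c * x) c x := by
    simpa using ((hasDerivAt_id x).const_mul c).const_add 1
  have hv := hlin.rpow_const (p := -(1 / (n : ℝ))) (Or.inl hpos.ne')
  have hp := Real.hasDerivAt_rpow_const (x := x) (p := 1 / (ρ * n)) (Or.inl hx.ne')
  have hpow : ((1 + c * x) ^ (-(1 / (n : ℝ)))) ^ (n + 1)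
      = (1 + c * x) ^ (-(1 / (n : ℝ)) - 1) := by
    rw [← Real.rpow_natCast, ← Real.rpow_mul hpos.le]
    congr 1
    push_cast
    field_simp
    ring
  have hv_eq : (1 + c * x) ^ (-(1 / (n : ℝ)))
      = (1 + c * x) ^ (-(1 / (n : ℝ)) - 1) * (1 + c * x) := by
    rw [Real.rpow_sub_one hpos.ne']
    field_simp
  have hx_eq : x ^ (1 / (ρ * n)) = x ^ (1 / (ρ * n) - 1) * x := by
    rw [Real.rpow_sub_one hx.ne']
    field_simp
  refine (hp.mul hv).congr_deriv ?_
  rw [hpow, hx_eq, hv_eq]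
  field_simp
  ring

lemma integral_rpow_mul_rpow_affine {ρ c b : ℝ} {n : ℕ} (hρ : 0 < ρ) (hn : n ≠ 0)
    (hc : 0 ≤ c) (hb : 0 ≤ b) :
    1 / (ρ * n) * ∫ x in (0 : ℝ)..b, ((1 - ρ) * (1 + c * x) ^ (-(1 / (n : ℝ)))
        + ρ * ((1 + c * x) ^ (-(1 / (n : ℝ)))) ^ (n + 1)) * x ^ (1 / (ρ * n) - 1)
      = b ^ (1 / (ρ * n)) * (1 + c * b) ^ (-(1 / (n : ℝ))) := by
  have hs : 0 < 1 / (ρ * n) := by positivity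
  have hv : ContinuousOn (fun x : ℝ => (1 + c * x) ^ (-(1 / (n : ℝ)))) (Icc 0 b) := by
    refine ContinuousOn.rpow_const (by fun_prop) fun x hx => Or.inl ?_
    have := mul_nonneg hc hx.1
    positivity
  have hF : ContinuousOn
      (fun x : ℝ => x ^ (1 / (ρ * n)) * (1 + c * x) ^ (-(1 / (n : ℝ)))) (Icc 0 b) :=
    (Real.continuous_rpow_const hs.le).continuousOn.mul hv
  have hint : IntervalIntegrable (fun x : ℝ => x ^ (1 / (ρ * n) - 1)) volume 0 b :=
    intervalIntegral.intervalIntegrable_rpow' (by linarith)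
  rw [← intervalIntegral.integral_const_mul,
    intervalIntegral.integral_eq_sub_of_hasDerivAt_of_le hb hF
      (fun x hx => hasDerivAt_rpow_mul_rpow_affine hρ.ne' hn hc hx.1)
      ((hint.continuousOn_mul ?_).const_mul _)]
  · rw [Real.zero_rpow hs.ne', zero_mul, sub_zero]
  · rw [uIcc_of_le hb]
    exact (hv.const_mul _).add ((hv.pow _).const_mul _)

/-- Example 3 of the paper: with `φ(x) = (1-ρ)x + ρ x^{n+1}`,
`b = ρn + 1`, `γ = (ρn - 1)/(ρn)`, `u(t) = (1 + nt/(ρn+1))^{-1/n}` and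
`g = (1-ρ) u + ρ u^{n+1}`, one has `(1-γ) b^{γ-1} ∫_0^b g(tx/b) x^{-γ} dx = u(t)`,
hence `g` satisfies the Laplace-transform fixed-point equation for `(φ, μ)`. -/
theorem example3_fixed_point
    (ρ : ℝ) (hρ0 : 0 < ρ) (hρ1 : ρ ≤ 1) (n : ℕ) (hn : 1 ≤ n) (hρn : 1 < ρ * n)
    (b γ : ℝ) (hb : b = ρ * n + 1) (hγ : γ = (ρ * n - 1) / (ρ * n))
    (u g : ℝ → ℝ)
    (hu : ∀ t, u t = (1 + (n : ℝ) * t / (ρ * n + 1)) ^ (-(1 / (n : ℝ))))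
    (hg : ∀ t, g t = (1 - ρ) * u t + ρ * (u t) ^ (n + 1))
    (μ : Measure ℝ)
    (hμ : μ = volume.withDensity (fun x =>
      ENNReal.ofReal ((Ioo (0 : ℝ) b).indicator
        (fun x => (1 - γ) * b ^ (γ - 1) * x ^ (-γ)) x))) :
    ∀ t ≥ (0 : ℝ),
      (1 - γ) * b ^ (γ - 1) * (∫ x in (0 : ℝ)..b, g (t * x / b) * x ^ (-γ)) = u t
      ∧ g t = (1 - ρ) * (∫ x, g (t * x / b) ∂μ)
          + ρ * (∫ x, g (t * x / b) ∂μ) ^ (n + 1) := by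
  intro t ht
  have hn0 : n ≠ 0 := by omega
  have hρn0 : 0 < ρ * n := by linarith
  have hb0 : 0 < b := by linarith
  have h1γ : 1 - γ = 1 / (ρ * n) := by rw [hγ]; field_simp; ring
  have hγs : -γ = 1 / (ρ * n) - 1 := by linarith
  have hu' : ∀ x, u (t * x / b) = (1 + n * t / b ^ 2 * x) ^ (-(1 / (n : ℝ))) := fun x => by
    rw [hu, ← hb]
    congr 2
    field_simp
  have hI : (1 - γ) * b ^ (γ - 1) * (∫ x in (0 : ℝ)..b, g (t * x / b) * x ^ (-γ)) = u t := by
    have key := integral_rpow_mul_rpow_affine (c := n * t / b ^ 2) hρ0 hn0 (by positivity) hb0.le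
    simp only [← hu', ← hg] at key
    rw [mul_div_cancel_right₀ t hb0.ne', ← hγs, ← h1γ] at key
    rw [mul_right_comm, key, mul_right_comm, ← Real.rpow_add hb0]
    simp
  have hμI : ∫ x, g (t * x / b) ∂μ = u t := by
    have hmeas : Measurable fun x : ℝ => (Ioo (0 : ℝ) b).indicator
        (fun x => (1 - γ) * b ^ (γ - 1) * x ^ (-γ)) x :=
      Measurable.indicator (by fun_prop) measurableSet_Ioo
    have hnonneg : ∀ x, 0 ≤ (Ioo (0 : ℝ) b).indicator
        (fun x => (1 - γ) * b ^ (γ - 1) * x ^ (-γ)) x :=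
      indicator_nonneg fun x hx => by
        have := hx.1
        have : 0 ≤ 1 - γ := by rw [h1γ]; positivity
        positivity
    rw [hμ, integral_withDensity_eq_integral_toReal_smul hmeas.ennreal_ofReal
      (Filter.Eventually.of_forall fun _ => ENNReal.ofReal_lt_top), ← hI,
      ← intervalIntegral.integral_const_mul, intervalIntegral.integral_of_le hb0.le,
      integral_Ioc_eq_integral_Ioo, ← integral_indicator measurableSet_Ioo]
    refine integral_congr_ae (Filter.Eventually.of_forall fun x => ?_)
    simp only [ENNReal.toReal_ofReal (hnonneg x), smul_eq_mul]
    by_cases hx : x ∈ Ioo 0 b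
    · simp only [indicator_of_mem hx]
      ring
    · simp only [indicator_of_notMem hx, zero_mul]
  exact ⟨hI, by rw [hμI, hg]⟩

end
end

section
/- Let 1/2 ≤ p < 1, set b = 1/(1−p) and α = 2(1−p) (so α b = 2 and γ = 0). Define g(t) = (2p−1)/(2p) + 1/( 2p √(4pt+1) ) and u(t) = (2p−1)/p + 2(1−p)/( p (√(4pt+1) + 1) ) for t ≥ 0. Then for every t ≥ 0: (i) u(t) = 1 − α + (α/b) ∫_0^b g(t x / b) dx, and (ii) g(t) = (1−p) u(t)/(1 − p u(t)). Hence g satisfies the Laplace-transform fixed-point equation g(t) = φ( ∫ g(t x / b) μ(dx) ) with φ(x) = (1−p)x/(1−px) and μ(dx) = (1−α) δ_0(dx) + (α/b) 1_{(0,b)}(x) dx. -/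
open MeasureTheory Set

noncomputable section

/-- The average of `1 / √(k x + 1)` over `[0, b]`, in a form valid for `k = 0` as well. -/
theorem integral_one_div_sqrt_mul_add_one {k b : ℝ} (hk : 0 ≤ k) (hb : 0 ≤ b) :
    ∫ x in (0 : ℝ)..b, 1 / Real.sqrt (k * x + 1) = 2 * b / (Real.sqrt (k * b + 1) + 1) := by
  have hpos : ∀ x ∈ uIcc 0 b, 0 < k * x + 1 := by
    intro x hx
    rw [uIcc_of_le hb] at hx
    have := mul_nonneg hk hx.1
    linarith
  have hderiv : ∀ x ∈ uIcc 0 b, HasDerivAt (fun y => 2 * y / (Real.sqrt (k * y + 1) + 1))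
      (1 / Real.sqrt (k * x + 1)) x := by
    intro x hx
    have hs := Real.sqrt_pos.2 (hpos x hx)
    have hsq := Real.sq_sqrt (hpos x hx).le
    have hlin : HasDerivAt (fun y : ℝ => k * y + 1) k x := by
      simpa using ((hasDerivAt_id x).const_mul k).add_const 1
    have hnum : HasDerivAt (fun y : ℝ => 2 * y) 2 x := by
      simpa using (hasDerivAt_id x).const_mul (2 : ℝ)
    refine (hnum.div ((hlin.sqrt (hpos x hx).ne').add_const 1) (by positivity)).congr_deriv ?_
    set s := Real.sqrt (k * x + 1)
    have hkx : k * x = s ^ 2 - 1 := by linarith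
    field_simp
    linear_combination (-1) * hkx
  have hcont : ContinuousOn (fun x => 1 / Real.sqrt (k * x + 1)) (uIcc 0 b) :=
    ContinuousOn.div continuousOn_const (by fun_prop)
      fun x hx => (Real.sqrt_pos.2 (hpos x hx)).ne'
  rw [intervalIntegral.integral_eq_sub_of_hasDerivAt hderiv hcont.intervalIntegrable]
  simp

/-- Integration against a mixture of the Dirac mass at `0` and a multiple of Lebesgue measure on
`(0, b)`. -/
theorem integral_dirac_add_withDensity_Ioo {f : ℝ → ℝ} {b a c : ℝ} (hb : 0 ≤ b) (ha : 0 ≤ a)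
    (hc : 0 ≤ c) (hf : ContinuousOn f (Icc 0 b)) :
    ∫ x, f x ∂(ENNReal.ofReal a • Measure.dirac (0 : ℝ)
      + volume.withDensity ((Ioo (0 : ℝ) b).indicator fun _ => ENNReal.ofReal c))
      = a * f 0 + c * ∫ x in (0 : ℝ)..b, f x := by
  have hint : Integrable f (volume.restrict (Ioo 0 b)) :=
    (hf.integrableOn_Icc).mono_set Ioo_subset_Icc_self
  have hdirac : Integrable f (Measure.dirac (0 : ℝ)) := integrable_dirac (by simp)
  rw [withDensity_indicator measurableSet_Ioo, withDensity_const,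
    integral_add_measure (hdirac.smul_measure ENNReal.ofReal_ne_top)
      (hint.smul_measure ENNReal.ofReal_ne_top),
    integral_smul_measure, integral_smul_measure, integral_dirac,
    intervalIntegral.integral_of_le hb, integral_Ioc_eq_integral_Ioo,
    ENNReal.toReal_ofReal ha, ENNReal.toReal_ofReal hc, smul_eq_mul, smul_eq_mul]

/-- Example 5 of the paper: with `φ(x) = (1-p)x/(1-px)`,
`b = 1/(1-p)`, `α = 2(1-p)` (so `αb = 2`, `γ = 0`), the explicit functions
`g(t) = (2p-1)/(2p) + 1/(2p√(4pt+1))` and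
`u(t) = (2p-1)/p + 2(1-p)/(p(√(4pt+1)+1))` satisfy the averaging identity and
`g = φ ∘ u`, hence `g` satisfies the Laplace-transform fixed-point equation
for `(φ, μ)` with `μ = (1-α) δ₀ + (α/b) 1_{(0,b)} dx`. -/
theorem example5_fixed_point
    (p : ℝ) (hp0 : 1 / 2 ≤ p) (hp1 : p < 1)
    (b α : ℝ) (hb : b = 1 / (1 - p)) (hα : α = 2 * (1 - p))
    (g u : ℝ → ℝ)
    (hg : ∀ t, g t = (2 * p - 1) / (2 * p) + 1 / (2 * p * Real.sqrt (4 * p * t + 1)))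
    (hu : ∀ t, u t = (2 * p - 1) / p
      + 2 * (1 - p) / (p * (Real.sqrt (4 * p * t + 1) + 1)))
    (μ : Measure ℝ)
    (hμ : μ = (ENNReal.ofReal (1 - α)) • Measure.dirac (0 : ℝ)
      + volume.withDensity
          ((Ioo (0 : ℝ) b).indicator fun _ => ENNReal.ofReal (α / b))) :
    α * b = 2
    ∧ ∀ t ≥ (0 : ℝ),
        u t = 1 - α + (α / b) * ∫ x in (0 : ℝ)..b, g (t * x / b)
        ∧ g t = (1 - p) * u t / (1 - p * u t)
        ∧ g t = (1 - p) * (∫ x, g (t * x / b) ∂μ)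
            / (1 - p * ∫ x, g (t * x / b) ∂μ) := by
  have hp : 0 < p := by linarith
  have hq : 0 < 1 - p := by linarith
  have hb_pos : 0 < b := by rw [hb]; positivity
  have hα_pos : 0 < α := by rw [hα]; positivity
  refine ⟨by rw [hα, hb]; field_simp, fun t ht => ?_⟩
  have hk : 0 ≤ 4 * p * t / b := by positivity
  have hg_comp : ∀ x, g (t * x / b) = (2 * p - 1) / (2 * p)
      + 1 / (2 * p) * (1 / Real.sqrt (4 * p * t / b * x + 1)) := by
    intro x
    rw [hg, show 4 * p * (t * x / b) = 4 * p * t / b * x by ring, one_div_mul_one_div]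
  have hcont' : ContinuousOn (fun x => 1 / Real.sqrt (4 * p * t / b * x + 1)) (Icc 0 b) := by
    refine ContinuousOn.div continuousOn_const (by fun_prop) fun x hx => ?_
    have := mul_nonneg hk hx.1
    exact (Real.sqrt_pos.2 (by linarith)).ne'
  have hcont : ContinuousOn (fun x => g (t * x / b)) (Icc 0 b) := by
    simp only [hg_comp]
    exact continuousOn_const.add (continuousOn_const.mul hcont')
  have hs : 0 < Real.sqrt (4 * p * t + 1) := Real.sqrt_pos.2 (by positivity)
  have havg : u t = 1 - α + (α / b) * ∫ x in (0 : ℝ)..b, g (t * x / b) := by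
    simp only [hg_comp]
    rw [intervalIntegral.integral_add intervalIntegrable_const
        ((hcont'.intervalIntegrable_of_Icc hb_pos.le).const_mul _),
      intervalIntegral.integral_const_mul, integral_one_div_sqrt_mul_add_one hk hb_pos.le,
      intervalIntegral.integral_const, div_mul_cancel₀ _ hb_pos.ne', hu, smul_eq_mul, hα]
    field_simp
    ring
  have hφ : g t = (1 - p) * u t / (1 - p * u t) := by
    rw [hg, hu]
    set s := Real.sqrt (4 * p * t + 1)
    have hden : 1 - p * ((2 * p - 1) / p + 2 * (1 - p) / (p * (s + 1)))
        = 2 * (1 - p) * s / (s + 1) := by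
      field_simp
      ring
    rw [hden]
    field_simp
    ring
  refine ⟨havg, hφ, ?_⟩
  have hg_zero : g (t * 0 / b) = 1 := by
    rw [hg_comp]
    simp
    field_simp
    ring
  have hmean : ∫ x, g (t * x / b) ∂μ = u t := by
    rw [hμ, integral_dirac_add_withDensity_Ioo hb_pos.le (by linarith) (by positivity) hcont,
      hg_zero, mul_one, ← havg]
  rw [hmean]
  exact hφ

end
end

section
/- Let 1/2 < p < 1, set b = (2−p)/(1−p), α = −2p(1−p)/(2p² − 4p + 1), and γ = 2(1−p)². Define u(t) = (2p−1)/p + 2(1−p)/( p (1 + √(t/(2−p) + 1)) ) and g(t) = (2p−1)²/(2p²) + 1/( 2p² √(t/(2−p) + 1) ) − 2(1−p)²/( p² (1 + √(t/(2−p) + 1)) ) for t ≥ 0. Then for every t ≥ 0: (i) u(t) = 1 − α + α(1−γ) b^{γ−1} ∫_0^b g(t x / b) x^{−γ} dx, and (ii) g(t) = (1−p) u(t)²/(1 − p u(t)). Hence g satisfies the Laplace-transform fixed-point equation g(t) = φ( ∫ g(t x / b) μ(dx) ) with φ(x) = (1−p)x²/(1−px) and μ(dx) = (1−α) δ_0(dx)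 + α(1−γ) b^{γ−1} x^{−γ} 1_{(0,b)}(x) dx. -/
open MeasureTheory Set

noncomputable section

/-- Product rule for the primitive of `x ↦ g (t x / b) x ^ (-γ)`, with `c = t / (b (2 - p))`. -/
theorem hasDerivAt_rpow_mul_sqrt_average (p c γ x : ℝ) (hp : p ≠ 0) (hγ : γ = 2 * (1 - p) ^ 2)
    (hc : 0 ≤ c) (hx : 0 < x) :
    HasDerivAt (fun x : ℝ => x ^ (1 - γ) * ((1 - γ) * ((2 * p - 1) / p
        + 2 * (1 - p) / (p * (1 + √(c * x + 1)))) - (2 * p - 1)))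
      ((1 - γ) * (2 * p * (1 - p) * (((2 * p - 1) ^ 2 / (2 * p ^ 2)
        + 1 / (2 * p ^ 2 * √(c * x + 1))
        - 2 * (1 - p) ^ 2 / (p ^ 2 * (1 + √(c * x + 1)))) * x ^ (-γ)))) x := by
  have hpos : 0 < c * x + 1 := by positivity
  have hr : 0 < √(c * x + 1) := Real.sqrt_pos.2 hpos
  have hsq : √(c * x + 1) ^ 2 = c * x + 1 := Real.sq_sqrt hpos.le
  have hlin : HasDerivAt (fun x : ℝ => c * x + 1) c x := by
    simpa using ((hasDerivAt_id x).const_mul c).add_const 1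
  have hden := ((hlin.sqrt hpos.ne').const_add 1).const_mul p
  have hu := ((((hasDerivAt_const x (2 * (1 - p))).div hden (by positivity)).const_add
    ((2 * p - 1) / p)).const_mul (1 - γ)).sub_const (2 * p - 1)
  have hpow := Real.hasDerivAt_rpow_const (x := x) (p := 1 - γ) (Or.inl hx.ne')
  refine (hpow.mul hu).congr_deriv ?_
  have hx1 : x ^ (1 - γ) = x * x ^ (-γ) := by
    rw [sub_eq_add_neg, Real.rpow_add hx, Real.rpow_one]
  have hx2 : x ^ (1 - γ - 1) = x ^ (-γ) := by congr 1; ring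
  simp only [Pi.div_apply, hx1, hx2]
  have hcx : c * x = √(c * x + 1) ^ 2 - 1 := by rw [hsq]; ring
  generalize √(c * x + 1) = r at *
  generalize x ^ (-γ) = y
  have key : x * ((0 * (p * (1 + r)) - 2 * (1 - p) * (p * (c / (2 * r)))) / (p * (1 + r)) ^ 2)
      = -((1 - p) * (r - 1) / (p * r * (1 + r))) := by
    field_simp
    linear_combination -(1 - p) * hcx
  have hfin : ((1 - γ) * ((2 * p - 1) / p + 2 * (1 - p) / (p * (1 + r))) - (2 * p - 1))
      + -((1 - p) * (r - 1) / (p * r * (1 + r)))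
      = 2 * p * (1 - p) * ((2 * p - 1) ^ 2 / (2 * p ^ 2)
        + 1 / (2 * p ^ 2 * r) - 2 * (1 - p) ^ 2 / (p ^ 2 * (1 + r))) := by
    rw [hγ]
    field_simp
    ring
  linear_combination (1 - γ) * y * hfin + (1 - γ) * y * key

/-- Integration against `c • δ₀ + w(x) 1_{(0,b)}(x) dx`. -/
theorem integral_smul_dirac_add_withDensity (c b : ℝ) (hc : 0 ≤ c) (hb : 0 ≤ b) (w f : ℝ → ℝ)
    (hw : Measurable w) (hw0 : ∀ x ∈ Ioo 0 b, 0 ≤ w x)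
    (hf : IntervalIntegrable (fun x => w x * f x) volume 0 b) :
    ∫ x, f x ∂(ENNReal.ofReal c • Measure.dirac (0 : ℝ)
      + volume.withDensity (fun x => ENNReal.ofReal ((Ioo (0 : ℝ) b).indicator w x)))
      = c * f 0 + ∫ x in (0 : ℝ)..b, w x * f x := by
  have hmeas : Measurable fun x => ENNReal.ofReal ((Ioo (0 : ℝ) b).indicator w x) :=
    (hw.indicator measurableSet_Ioo).ennreal_ofReal
  have hnn : ∀ x, 0 ≤ (Ioo (0 : ℝ) b).indicator w x := fun x => indicator_nonneg hw0 x
  have heq : (fun x => (ENNReal.ofReal ((Ioo (0 : ℝ) b).indicator w x)).toReal • f x)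
      = (Ioo (0 : ℝ) b).indicator fun x => w x * f x := by
    ext x
    rw [ENNReal.toReal_ofReal (hnn x), smul_eq_mul, indicator_mul_left]
  have hlt : ∀ᵐ x : ℝ, ENNReal.ofReal ((Ioo (0 : ℝ) b).indicator w x) < ⊤ :=
    Filter.Eventually.of_forall fun _ => ENNReal.ofReal_lt_top
  rw [integral_add_measure, integral_smul_measure, integral_dirac,
    integral_withDensity_eq_integral_toReal_smul hmeas hlt, heq,
    integral_indicator measurableSet_Ioo, ← integral_Ioc_eq_integral_Ioo,
    ← intervalIntegral.integral_of_le hb, ENNReal.toReal_ofReal hc, smul_eq_mul]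
  · exact (integrable_dirac (by simp)).smul_measure ENNReal.ofReal_ne_top
  · rw [integrable_withDensity_iff_integrable_smul' hmeas hlt, heq,
      integrable_indicator_iff measurableSet_Ioo, ← integrableOn_Ioc_iff_integrableOn_Ioo,
      ← intervalIntegrable_iff_integrableOn_Ioc_of_le hb]
    exact hf

/-- Example 6 of the paper: with `φ(x) = (1-p)x²/(1-px)`,
`b = (2-p)/(1-p)`, `α = -2p(1-p)/(2p² - 4p + 1)` and `γ = 2(1-p)²`, the explicit
functions `u` and `g` satisfy the averaging identity and `g = φ ∘ u`, hence `g`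
satisfies the Laplace-transform fixed-point equation for `(φ, μ)` with
`μ = (1-α) δ₀ + α(1-γ) b^{γ-1} x^{-γ} 1_{(0,b)} dx`. -/
theorem example6_fixed_point
    (p : ℝ) (hp0 : 1 / 2 < p) (hp1 : p < 1)
    (b α γ : ℝ) (hb : b = (2 - p) / (1 - p))
    (hα : α = -(2 * p * (1 - p)) / (2 * p ^ 2 - 4 * p + 1))
    (hγ : γ = 2 * (1 - p) ^ 2)
    (u g : ℝ → ℝ)
    (hu : ∀ t, u t = (2 * p - 1) / p
      + 2 * (1 - p) / (p * (1 + Real.sqrt (t / (2 - p) + 1))))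
    (hg : ∀ t, g t = (2 * p - 1) ^ 2 / (2 * p ^ 2)
      + 1 / (2 * p ^ 2 * Real.sqrt (t / (2 - p) + 1))
      - 2 * (1 - p) ^ 2 / (p ^ 2 * (1 + Real.sqrt (t / (2 - p) + 1))))
    (μ : Measure ℝ)
    (hμ : μ = (ENNReal.ofReal (1 - α)) • Measure.dirac (0 : ℝ)
      + volume.withDensity (fun x =>
          ENNReal.ofReal ((Ioo (0 : ℝ) b).indicator
            (fun x => α * (1 - γ) * b ^ (γ - 1) * x ^ (-γ)) x))) :
    ∀ t ≥ (0 : ℝ),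
      u t = 1 - α + α * (1 - γ) * b ^ (γ - 1)
          * ∫ x in (0 : ℝ)..b, g (t * x / b) * x ^ (-γ)
      ∧ g t = (1 - p) * (u t) ^ 2 / (1 - p * u t)
      ∧ g t = (1 - p) * (∫ x, g (t * x / b) ∂μ) ^ 2
          / (1 - p * ∫ x, g (t * x / b) ∂μ) := by
  intro t ht
  have hp : 0 < p := by linarith
  have h1p : 0 < 1 - p := by linarith
  have h2p : 0 < 2 - p := by linarith
  have hbpos : 0 < b := hb ▸ div_pos h2p h1p
  have hγ0 : 0 < 1 - γ := by rw [hγ]; nlinarith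
  have hden : 2 * p ^ 2 - 4 * p + 1 = -(1 - γ) := by rw [hγ]; ring
  have hαγ : α * (1 - γ) = 2 * p * (1 - p) := by
    rw [hα, hden]; field_simp
  have hαpos : 0 < α * (1 - γ) := by rw [hαγ]; positivity
  have hα1 : (1 - α) * (1 - γ) = 2 * p - 1 := by
    rw [sub_mul, hαγ, hγ]; ring
  have hα0 : 0 ≤ 1 - α := by
    refine le_of_mul_le_mul_right ?_ hγ0
    rw [hα1]; linarith
  set c := t / (b * (2 - p)) with hc
  have hc0 : 0 ≤ c := by positivity
  have harg : ∀ x, t * x / b / (2 - p) = c * x := fun x => by rw [hc]; field_simp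
  have hpos : ∀ x ∈ Icc 0 b, 0 < c * x + 1 := fun x hx => by
    have := mul_nonneg hc0 hx.1; linarith
  have hsqrt : ContinuousOn (fun x => √(c * x + 1)) (Icc 0 b) := by fun_prop
  have hgcont : ContinuousOn (fun x => g (t * x / b)) (Icc 0 b) := by
    simp only [hg, harg]
    refine (continuousOn_const.add (continuousOn_const.div (by fun_prop) fun x hx => ?_)).sub
      (continuousOn_const.div (by fun_prop) fun x _ => by positivity)
    have := Real.sqrt_pos.2 (hpos x hx)
    positivity
  have hint : IntervalIntegrable (fun x => g (t * x / b) * x ^ (-γ)) volume 0 b := by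
    refine (intervalIntegral.intervalIntegrable_rpow' (by linarith)).continuousOn_mul ?_
    rwa [uIcc_of_le hbpos.le]
  have hprim : (1 - γ) * (2 * p * (1 - p) * ∫ x in (0 : ℝ)..b, g (t * x / b) * x ^ (-γ))
      = b ^ (1 - γ) * ((1 - γ) * u t - (2 * p - 1)) := by
    have hcb : c * b = t / (2 - p) := by rw [hc]; field_simp
    have hftc := intervalIntegral.integral_eq_sub_of_hasDerivAt_of_le hbpos.le
      (f := fun x : ℝ => x ^ (1 - γ) * ((1 - γ) * ((2 * p - 1) / p
        + 2 * (1 - p) / (p * (1 + √(c * x + 1)))) - (2 * p - 1)))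
      (f' := fun x => (1 - γ) * (2 * p * (1 - p) * (g (t * x / b) * x ^ (-γ)))) ?_
      (fun x hx => by
        simp only [hg, harg]
        exact hasDerivAt_rpow_mul_sqrt_average p c γ x hp.ne' hγ hc0 hx.1)
      ((hint.const_mul _).const_mul _)
    · rw [intervalIntegral.integral_const_mul, intervalIntegral.integral_const_mul] at hftc
      rw [hftc, hu, hcb, Real.zero_rpow hγ0.ne']
      ring
    · refine (Real.continuous_rpow_const hγ0.le).continuousOn.mul
        ((continuousOn_const.mul (continuousOn_const.add
          (continuousOn_const.div (by fun_prop) fun x _ => by positivity))).sub continuousOn_const)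
  have hbb : b ^ (γ - 1) * b ^ (1 - γ) = 1 := by
    rw [← Real.rpow_add hbpos]; simp
  have havg : u t = 1 - α + α * (1 - γ) * b ^ (γ - 1)
      * ∫ x in (0 : ℝ)..b, g (t * x / b) * x ^ (-γ) := by
    refine mul_left_cancel₀ hγ0.ne' ?_
    rw [hαγ]
    linear_combination (-b ^ (γ - 1)) * hprim - ((1 - γ) * u t - (2 * p - 1)) * hbb - hα1
  have hphi : g t = (1 - p) * (u t) ^ 2 / (1 - p * u t) := by
    have hr : 0 < √(t / (2 - p) + 1) := Real.sqrt_pos.2 (by positivity)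
    rw [hg, hu]
    generalize √(t / (2 - p) + 1) = r at *
    have hd : 1 - p * ((2 * p - 1) / p + 2 * (1 - p) / (p * (1 + r)))
        = 2 * (1 - p) * r / (1 + r) := by
      field_simp
      ring
    rw [hd]
    field_simp
    ring
  have hg0 : g 0 = 1 := by
    rw [hg]
    norm_num
    field_simp
    ring
  have hμint : ∫ x, g (t * x / b) ∂μ = u t := by
    have hcomm : (fun x => α * (1 - γ) * b ^ (γ - 1) * x ^ (-γ) * g (t * x / b))
        = fun x => α * (1 - γ) * b ^ (γ - 1) * (g (t * x / b) * x ^ (-γ)) := by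
      ext x; ring
    rw [hμ, integral_smul_dirac_add_withDensity (1 - α) b hα0 hbpos.le _ _ (by fun_prop)
      (fun x hx => by have := hx.1; positivity) (by rw [hcomm]; exact hint.const_mul _), hcomm,
      intervalIntegral.integral_const_mul, havg]
    simp [hg0]
  exact ⟨havg, hphi, by rw [hμint]; exact hphi⟩

end
end
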